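/- The pushforward of Π← under the order-reversing map R equals the forward path measure weighted by the product of interior Radon–Nikodym derivatives: R_*Π← = Π→ . withDensity( (x₀,…,x_τ) ↦ ∏_{t=1}^{τ−1} (dμ_{t+1}/dμ_t)(x_t) ). -/

import Mathlib

open MeasureTheory ProbabilityTheory

/-- The law on `E^{n+1}` of an inhomogeneous Markov chain with initial distribution `μ0`
and transition kernels `κ 1, κ 2, …, κ n` (applied in this order). -/
noncomputable def chainLaw {E : Type*} [MeasurableSpace E] (μ0 : Measure E)
    (κ : ℕ → E → Measure E) : (n : ℕ) → Measure (Fin (n + 1) → E)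
  | 0 => μ0.map (fun x _ => x)
  | n + 1 => (chainLaw μ0 κ n).bind
      (fun p => (κ (n + 1) (p (Fin.last n))).map (fun x => Fin.snoc p x))

section BindLemmas

variable {α β γ : Type*} [MeasurableSpace α] [MeasurableSpace β] [MeasurableSpace γ]

lemma measurable_kernel_map_prodMk (η : Kernel α β) [IsSFiniteKernel η] {g : α → β → γ}
    (hg : Measurable (fun p : α × β => g p.1 p.2)) :
    Measurable (fun a => (η a).map (g a)) := by
  refine Measure.measurable_of_measurable_coe _ fun s hs => ?_
  have h : ∀ a, (η a).map (g a) s = η a (Prod.mk a ⁻¹' ((fun p : α × β => g p.1 p.2) ⁻¹' s)) :=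
    fun a => Measure.map_apply (hg.comp measurable_prodMk_left) hs
  simp_rw [h]
  exact Kernel.measurable_kernel_prodMk_left (hg hs)

lemma measurable_kernel_bind (η : Kernel α β) [IsSFiniteKernel η] {h : α → β → Measure γ}
    (hh : Measurable (fun p : α × β => h p.1 p.2)) :
    Measurable (fun a => (η a).bind (h a)) := by
  refine Measure.measurable_of_measurable_coe _ fun s hs => ?_
  have h' : ∀ a, (η a).bind (h a) s = ∫⁻ b, h a b s ∂(η a) :=
    fun a => Measure.bind_apply hs (hh.comp measurable_prodMk_left).aemeasurable
  simp_rw [h']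
  exact ((Measure.measurable_coe hs).comp hh).lintegral_kernel_prod_right'

lemma lintegral_bind_kernel_map (ν : Measure α) (η : Kernel α β) [IsSFiniteKernel η]
    {g : α → β → γ} (hg : Measurable (fun p : α × β => g p.1 p.2))
    {f : γ → ENNReal} (hf : Measurable f) :
    ∫⁻ c, f c ∂(ν.bind (fun a => (η a).map (g a))) = ∫⁻ a, ∫⁻ b, f (g a b) ∂(η a) ∂ν := by
  rw [Measure.lintegral_bind (measurable_kernel_map_prodMk η hg).aemeasurable hf.aemeasurable]
  exact lintegral_congr fun a => lintegral_map hf (hg.comp measurable_prodMk_left)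

lemma lintegral_lintegral_of_bind_eq_map_swap {ν : Measure α} {ν' : Measure β}
    {η : Kernel α β} [IsSFiniteKernel η] {η' : Kernel β α} [IsSFiniteKernel η']
    (h : ν.bind (fun a => (η a).map (fun b => (a, b)))
      = (ν'.bind (fun b => (η' b).map (fun a => (b, a)))).map Prod.swap)
    {f : α → β → ENNReal} (hf : Measurable (fun p : α × β => f p.1 p.2)) :
    ∫⁻ a, ∫⁻ b, f a b ∂(η a) ∂ν = ∫⁻ b, ∫⁻ a, f a b ∂(η' b) ∂ν' := by
  have key : ∫⁻ p, f p.1 p.2 ∂(ν.bind (fun a => (η a).map (fun b => (a, b))))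
      = ∫⁻ p, f p.1 p.2 ∂((ν'.bind (fun b => (η' b).map (fun a => (b, a)))).map Prod.swap) := by
    rw [h]
  rw [lintegral_map hf measurable_swap,
    lintegral_bind_kernel_map ν η (g := fun a b => (a, b)) measurable_id hf] at key
  exact key.trans (lintegral_bind_kernel_map ν' η' (g := fun b a => (b, a)) measurable_id
    (hf.comp measurable_swap))

end BindLemmas

section ChainLaw

variable {E : Type*} [MeasurableSpace E]

@[fun_prop]
lemma Measurable.finSnoc {α : Type*} [MeasurableSpace α] {n : ℕ} {f : α → Fin n → E} {g : α → E}
    (hf : Measurable f) (hg : Measurable g) :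
    Measurable (fun a => (Fin.snoc (f a) (g a) : Fin (n + 1) → E)) := by
  refine measurable_pi_lambda _ fun i => ?_
  refine Fin.lastCases ?_ (fun j => ?_) i
  · simpa using hg
  · simp only [Fin.snoc_castSucc]
    fun_prop

@[fun_prop]
lemma Measurable.finCons {α : Type*} [MeasurableSpace α] {n : ℕ} {f : α → Fin n → E} {g : α → E}
    (hf : Measurable f) (hg : Measurable g) :
    Measurable (fun a => (Fin.cons (g a) (f a) : Fin (n + 1) → E)) := by
  refine measurable_pi_lambda _ fun i => ?_
  refine Fin.cases ?_ (fun j => ?_) i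
  · simpa using hg
  · simp only [Fin.cons_succ]
    fun_prop

lemma measurable_finRev {n : ℕ} :
    Measurable (fun m : Fin n → E => fun i : Fin n => m i.rev) := by
  fun_prop

lemma lintegral_chainLaw_zero (κ : ℕ → E → Measure E) (ν : Measure E)
    {f : (Fin 1 → E) → ENNReal} (hf : Measurable f) :
    ∫⁻ m, f m ∂(chainLaw ν κ 0) = ∫⁻ x, f (fun _ => x) ∂ν :=
  lintegral_map hf (measurable_pi_lambda _ fun _ => measurable_id)

variable (κ : ℕ → Kernel E E) [∀ t, IsMarkovKernel (κ t)]

lemma measurable_chainLaw_step (n : ℕ) :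
    Measurable (fun p : Fin (n + 1) → E =>
      (κ (n + 1) (p (Fin.last n))).map (fun x => (Fin.snoc p x : Fin (n + 2) → E))) :=
  measurable_kernel_map_prodMk
    ((κ (n + 1)).comap (fun p : Fin (n + 1) → E => p (Fin.last n)) (measurable_pi_apply _))
    (g := fun (p : Fin (n + 1) → E) x => (Fin.snoc p x : Fin (n + 2) → E)) (by fun_prop)

lemma lintegral_chainLaw_succ (ν : Measure E) (n : ℕ)
    {f : (Fin (n + 2) → E) → ENNReal} (hf : Measurable f) :
    ∫⁻ m, f m ∂(chainLaw ν (fun t x => κ t x) (n + 1))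
      = ∫⁻ m, ∫⁻ x, f (Fin.snoc m x) ∂(κ (n + 1) (m (Fin.last n)))
          ∂(chainLaw ν (fun t x => κ t x) n) :=
  lintegral_bind_kernel_map _
    ((κ (n + 1)).comap (fun p : Fin (n + 1) → E => p (Fin.last n)) (measurable_pi_apply _))
    (g := fun (p : Fin (n + 1) → E) x => (Fin.snoc p x : Fin (n + 2) → E)) (by fun_prop) hf

lemma measurable_lintegral_chainLaw_step (n : ℕ) {α : Type*} [MeasurableSpace α]
    {f : α → (Fin (n + 2) → E) → ENNReal}
    (hf : Measurable (fun p : α × (Fin (n + 2) → E) => f p.1 p.2)) :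
    Measurable (fun p : α × (Fin (n + 1) → E) =>
      ∫⁻ x, f p.1 (Fin.snoc p.2 x) ∂(κ (n + 1) (p.2 (Fin.last n)))) := by
  refine Measurable.lintegral_kernel_prod_right'
    (κ := (κ (n + 1)).comap (fun p : α × (Fin (n + 1) → E) => p.2 (Fin.last n)) (by fun_prop))
    (f := fun q : (α × (Fin (n + 1) → E)) × E => f q.1.1 (Fin.snoc q.1.2 q.2)) ?_
  exact hf.comp (f := fun q : (α × (Fin (n + 1) → E)) × E =>
    (q.1.1, (Fin.snoc q.1.2 q.2 : Fin (n + 2) → E))) (by fun_prop)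

lemma measurable_lintegral_snoc (n : ℕ) {f : (Fin (n + 2) → E) → ENNReal} (hf : Measurable f) :
    Measurable (fun m : Fin (n + 1) → E =>
      ∫⁻ x, f (Fin.snoc m x) ∂(κ (n + 1) (m (Fin.last n)))) :=
  (measurable_lintegral_chainLaw_step κ n (α := Unit) (f := fun _ => f)
    (hf.comp measurable_snd)).comp (measurable_prodMk_left (x := ()))

instance isProbabilityMeasure_chainLaw (ν : Measure E) [IsProbabilityMeasure ν] (n : ℕ) :
    IsProbabilityMeasure (chainLaw ν (fun t x => κ t x) n) := by
  constructor
  rw [← lintegral_one]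
  induction n with
  | zero => rw [lintegral_chainLaw_zero _ ν measurable_const]; simp
  | succ n ih => rw [lintegral_chainLaw_succ κ ν n measurable_const]; simpa using ih

/-- The chain law started at a point, as a Markov kernel in that point. -/
noncomputable def chainKernel (n : ℕ) : Kernel E (Fin (n + 1) → E) where
  toFun x := chainLaw (Measure.dirac x) (fun t x => κ t x) n
  measurable' := by
    induction n with
    | zero =>
      exact (Measure.measurable_map _ (measurable_pi_lambda _ fun _ => measurable_id)).comp
        Measure.measurable_dirac
    | succ n ih => exact (Measure.measurable_bind' (measurable_chainLaw_step κ n)).comp ih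

instance isMarkovKernel_chainKernel (n : ℕ) : IsMarkovKernel (chainKernel κ n) :=
  ⟨fun x => isProbabilityMeasure_chainLaw κ (Measure.dirac x) n⟩

lemma lintegral_chainLaw (ν : Measure E) (n : ℕ)
    {f : (Fin (n + 1) → E) → ENNReal} (hf : Measurable f) :
    ∫⁻ m, f m ∂(chainLaw ν (fun t x => κ t x) n) = ∫⁻ x, ∫⁻ m, f m ∂(chainKernel κ n x) ∂ν := by
  induction n with
  | zero =>
    rw [lintegral_chainLaw_zero _ ν hf]
    refine lintegral_congr fun x => ?_
    refine Eq.symm ((lintegral_chainLaw_zero (fun t x => κ t x) (Measure.dirac x) hf).trans ?_)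
    exact lintegral_dirac' x (hf.comp (measurable_pi_lambda _ fun _ => measurable_id))
  | succ n ih =>
    rw [lintegral_chainLaw_succ κ ν n hf, ih]
    · exact lintegral_congr fun x => (lintegral_chainLaw_succ κ (Measure.dirac x) n hf).symm
    · exact measurable_lintegral_snoc κ n hf

lemma lintegral_chainKernel_apply_zero (n : ℕ) (y : E)
    {f : E → (Fin (n + 1) → E) → ENNReal}
    (hf : Measurable (fun p : E × (Fin (n + 1) → E) => f p.1 p.2)) :
    ∫⁻ m, f (m 0) m ∂(chainKernel κ n y) = ∫⁻ m, f y m ∂(chainKernel κ n y) := by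
  have h1 : Measurable (fun m : Fin (n + 1) → E => f (m 0) m) :=
    hf.comp (f := fun m : Fin (n + 1) → E => (m 0, m)) (by fun_prop)
  have h2 : Measurable (fun m : Fin (n + 1) → E => f y m) :=
    hf.comp measurable_prodMk_left
  induction n with
  | zero =>
    refine (lintegral_chainLaw_zero (fun t x => κ t x) _ h1).trans
      (Eq.trans ?_ (lintegral_chainLaw_zero (fun t x => κ t x) _ h2).symm)
    have hc : Measurable (fun (x : E) (_ : Fin 1) => x) :=
      measurable_pi_lambda _ fun _ => measurable_id
    exact (lintegral_dirac' y (h1.comp hc)).trans (lintegral_dirac' y (h2.comp hc)).symm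
  | succ n ih =>
    refine (lintegral_chainLaw_succ κ _ n h1).trans
      (Eq.trans ?_ (lintegral_chainLaw_succ κ _ n h2).symm)
    have hg := measurable_lintegral_chainLaw_step κ n hf
    refine Eq.trans ?_ (ih
      (f := fun z m => ∫⁻ x, f z (Fin.snoc m x) ∂(κ (n + 1) (m (Fin.last n)))) hg
      (hg.comp (f := fun m : Fin (n + 1) → E => (m 0, m)) (by fun_prop))
      (hg.comp measurable_prodMk_left))
    refine lintegral_congr fun m => lintegral_congr fun x => ?_
    have : (Fin.snoc m x : Fin (n + 2) → E) 0 = m 0 := Fin.snoc_castSucc (α := fun _ => E) x m 0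
    rw [this]

lemma lintegral_chainKernel_succ_cons (n : ℕ) (x : E)
    {f : (Fin (n + 2) → E) → ENNReal} (hf : Measurable f) :
    ∫⁻ m, f m ∂(chainKernel κ (n + 1) x)
      = ∫⁻ y, ∫⁻ m, f (Fin.cons x m) ∂(chainKernel (fun t => κ (t + 1)) n y) ∂(κ 1 x) := by
  have hcons : Measurable (fun m : Fin (n + 1) → E => f (Fin.cons x m)) := hf.comp (by fun_prop)
  refine (lintegral_chainLaw_succ κ _ n hf).trans ?_
  induction n with
  | zero =>
    have hstep := measurable_lintegral_snoc κ 0 hf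
    have hc : Measurable (fun (x : E) (_ : Fin 1) => x) :=
      measurable_pi_lambda _ fun _ => measurable_id
    refine (lintegral_chainLaw_zero _ _ hstep).trans ?_
    refine (lintegral_dirac' x (hstep.comp hc)).trans ?_
    refine lintegral_congr fun y => ?_
    refine Eq.symm ((lintegral_chainLaw_zero (fun t x => κ (t + 1) x) _ hcons).trans ?_)
    refine (lintegral_dirac' y (hcons.comp hc)).trans ?_
    change f _ = f _
    congr 1
    funext i
    fin_cases i <;> rfl
  | succ n ih =>
    have hstep := measurable_lintegral_snoc κ (n + 1) hf
    refine (lintegral_chainLaw_succ κ _ n hstep).trans ?_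
    refine (ih hstep (hstep.comp (f := fun m : Fin (n + 1) → E =>
      (Fin.cons x m : Fin (n + 2) → E)) (by fun_prop))).trans ?_
    refine lintegral_congr fun y => ?_
    refine Eq.symm ((lintegral_chainLaw_succ (fun t => κ (t + 1)) _ n hcons).trans ?_)
    refine lintegral_congr fun m => ?_
    have hlast : (Fin.cons x m : Fin (n + 2) → E) (Fin.last (n + 1)) = m (Fin.last n) := rfl
    simp only [hlast]
    refine lintegral_congr fun z => ?_
    rw [Fin.cons_snoc_eq_snoc_cons]

end ChainLaw

lemma lintegral_chainLaw_reverse {E : Type*} [MeasurableSpace E] (n : ℕ)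
    (μ : ℕ → Measure E) [∀ t, IsProbabilityMeasure (μ t)]
    (hac : ∀ t, 1 ≤ t → t ≤ n + 1 → μ (t + 1) ≪ μ t)
    (κ : ℕ → Kernel E E) [∀ t, IsMarkovKernel (κ t)]
    (hrev : ∀ t, 2 ≤ t → t ≤ n + 1 →
      ((μ t).bind (fun x => ((κ t) x).map (fun y => (x, y)))).map Prod.swap
        = (μ t).bind (fun x => ((κ t) x).map (fun y => (x, y))))
    {G : (Fin (n + 1) → E) → ENNReal} (hG : Measurable G) :
    ∫⁻ m, G (fun i => m i.rev) ∂(chainLaw (μ (n + 2)) (fun t x => κ (n + 2 - t) x) n)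
      = ∫⁻ m, (∏ i : Fin (n + 1), (μ ((i : ℕ) + 2)).rnDeriv (μ ((i : ℕ) + 1)) (m i)) * G m
          ∂(chainLaw (μ 1) (fun t x => κ (t + 1) x) n) := by
  have hrn : ∀ k (f : E → ENNReal), 1 ≤ k → k ≤ n + 1 → Measurable f →
      ∫⁻ x, f x ∂(μ (k + 1)) = ∫⁻ x, (μ (k + 1)).rnDeriv (μ k) x * f x ∂(μ k) :=
    fun k f h1 h2 hf => (lintegral_rnDeriv_mul (hac k h1 h2) hf.aemeasurable).symm
  have hw : ∀ n, Measurable (fun m : Fin (n + 1) → E =>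
      ∏ i : Fin (n + 1), (μ ((i : ℕ) + 2)).rnDeriv (μ ((i : ℕ) + 1)) (m i)) := fun n =>
    Finset.measurable_prod _ fun i _ => (Measure.measurable_rnDeriv _ _).comp (measurable_pi_apply i)
  induction n with
  | zero =>
    have hc : Measurable (fun (x : E) (_ : Fin 1) => x) :=
      measurable_pi_lambda _ fun _ => measurable_id
    refine (lintegral_chainLaw_zero _ _ (hG.comp measurable_finRev)).trans
      (Eq.trans ?_ (lintegral_chainLaw_zero _ _ ((hw 0).mul hG)).symm)
    simpa using hrn 1 _ le_rfl le_rfl (hG.comp hc)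
  | succ n ih =>
    have hGr : Measurable (fun m : Fin (n + 2) → E => G (fun i => m i.rev)) :=
      hG.comp measurable_finRev
    have hGs : Measurable (fun p : (Fin (n + 1) → E) × E => G (Fin.snoc p.1 p.2)) :=
      hG.comp (by fun_prop)
    set r := (μ (n + 3)).rnDeriv (μ (n + 2)) with hr
    have hrm : Measurable r := Measure.measurable_rnDeriv _ _
    have hH : Measurable (fun p : E × (Fin (n + 1) → E) =>
        ∫⁻ x, r x * G (Fin.snoc p.2 x) ∂(κ (n + 2) p.1)) :=
      Measurable.lintegral_kernel_prod_right'
        (κ := (κ (n + 2)).comap (fun p : E × (Fin (n + 1) → E) => p.1) measurable_fst)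
        (f := fun q : (E × (Fin (n + 1) → E)) × E => r q.2 * G (Fin.snoc q.1.2 q.2))
        ((hrm.comp measurable_snd).mul (hG.comp (by fun_prop)))
    have hbk : (fun t => κ (n + 3 - (t + 1))) = fun t => κ (n + 2 - t) := by
      funext t; congr 1; omega
    have hI : Measurable (fun p : E × E => ∫⁻ m, G (Fin.snoc (fun i => m i.rev) p.1)
        ∂(chainKernel (fun t => κ (n + 2 - t)) n p.2)) :=
      Measurable.lintegral_kernel_prod_right'
        (κ := (chainKernel (fun t => κ (n + 2 - t)) n).comap (fun p : E × E => p.2) measurable_snd)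
        (f := fun q : (E × E) × (Fin (n + 1) → E) => G (Fin.snoc (fun i => q.2 i.rev) q.1.1))
        (hG.comp (by fun_prop))
    have hIx : Measurable (fun x => ∫⁻ y, ∫⁻ m, G (Fin.snoc (fun i => m i.rev) x)
        ∂(chainKernel (fun t => κ (n + 2 - t)) n y) ∂(κ (n + 2) x)) :=
      Measurable.lintegral_kernel_prod_right' hI
    calc ∫⁻ m, G (fun i => m i.rev) ∂(chainLaw (μ (n + 3)) (fun t x => κ (n + 3 - t) x) (n + 1))
        = ∫⁻ x, ∫⁻ y, ∫⁻ m, G (Fin.snoc (fun i => m i.rev) x)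
            ∂(chainKernel (fun t => κ (n + 2 - t)) n y) ∂(κ (n + 2) x) ∂(μ (n + 3)) := by
          rw [lintegral_chainLaw (fun t => κ (n + 3 - t)) _ _ hGr]
          refine lintegral_congr fun x => ?_
          rw [lintegral_chainKernel_succ_cons (fun t => κ (n + 3 - t)) n x hGr]
          refine lintegral_congr fun y => ?_
          simp only [hbk]
          refine lintegral_congr fun m => ?_
          congr 1
          funext i
          refine Fin.lastCases ?_ (fun j => ?_) i
          · simp
          · simp [Fin.rev_castSucc]
      _ = ∫⁻ x, ∫⁻ y, r x * ∫⁻ m, G (Fin.snoc (fun i => m i.rev) x)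
            ∂(chainKernel (fun t => κ (n + 2 - t)) n y) ∂(κ (n + 2) x) ∂(μ (n + 2)) := by
          rw [hrn (n + 2) _ (by omega) (by omega) hIx]
          refine lintegral_congr fun x => ?_
          exact (lintegral_const_mul _ (hI.comp measurable_prodMk_left)).symm
      _ = ∫⁻ y, ∫⁻ x, r x * ∫⁻ m, G (Fin.snoc (fun i => m i.rev) x)
            ∂(chainKernel (fun t => κ (n + 2 - t)) n y) ∂(κ (n + 2) y) ∂(μ (n + 2)) :=
          lintegral_lintegral_of_bind_eq_map_swap (hrev (n + 2) (by omega) (by omega)).symm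
            ((hrm.comp measurable_fst).mul hI)
      _ = ∫⁻ y, ∫⁻ m, ∫⁻ x, r x * G (Fin.snoc (fun i => m i.rev) x) ∂(κ (n + 2) y)
            ∂(chainKernel (fun t => κ (n + 2 - t)) n y) ∂(μ (n + 2)) := by
          refine lintegral_congr fun y => ?_
          rw [lintegral_lintegral_swap]
          · refine lintegral_congr fun x => ?_
            exact (lintegral_const_mul _ (hGs.comp (measurable_finRev.prodMk measurable_const))).symm
          · refine Measurable.aemeasurable ((hrm.comp measurable_snd).mul ?_)
            exact hGs.comp ((measurable_finRev.comp measurable_fst).prodMk measurable_snd)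
      _ = ∫⁻ y, ∫⁻ m, ∫⁻ x, r x * G (Fin.snoc (fun i => m i.rev) x) ∂(κ (n + 2) (m 0))
            ∂(chainKernel (fun t => κ (n + 2 - t)) n y) ∂(μ (n + 2)) := by
          refine lintegral_congr fun y => ?_
          exact (lintegral_chainKernel_apply_zero (fun t => κ (n + 2 - t)) n y
            (f := fun z m => ∫⁻ x, r x * G (Fin.snoc (fun i => m i.rev) x) ∂(κ (n + 2) z))
            (hH.comp (measurable_fst.prodMk (measurable_finRev.comp measurable_snd)))).symm
      _ = ∫⁻ m, (∏ i : Fin (n + 1), (μ ((i : ℕ) + 2)).rnDeriv (μ ((i : ℕ) + 1)) (m i))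
            * ∫⁻ x, r x * G (Fin.snoc m x) ∂(κ (n + 2) (m (Fin.last n)))
          ∂(chainLaw (μ 1) (fun t x => κ (t + 1) x) n) := by
          have hHl : Measurable (fun m : Fin (n + 1) → E =>
              ∫⁻ x, r x * G (Fin.snoc m x) ∂(κ (n + 2) (m (Fin.last n)))) :=
            hH.comp (f := fun m : Fin (n + 1) → E => (m (Fin.last n), m)) (by fun_prop)
          have hHr := hHl.comp measurable_finRev
          simp only [Function.comp_def, Fin.rev_last] at hHr
          rw [← ih (fun t h1 h2 => hac t h1 (by omega)) (fun t h1 h2 => hrev t h1 (by omega))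
            hHl (fun k f h1 h2 => hrn k f h1 (by omega)),
            ← lintegral_chainLaw (fun t => κ (n + 2 - t)) _ _ hHr]
          simp only [Fin.rev_last]
      _ = _ := by
          refine Eq.symm ((lintegral_chainLaw_succ (fun t => κ (t + 1)) _ n
            ((hw (n + 1)).mul hG)).trans ?_)
          refine lintegral_congr fun m => ?_
          refine Eq.symm ((lintegral_const_mul _
            (hrm.mul (hGs.comp measurable_prodMk_left))).symm.trans ?_)
          refine lintegral_congr fun x => ?_
          simp only [Pi.mul_apply]
          rw [Fin.prod_univ_castSucc (n := n + 1)]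
          simp only [Fin.snoc_castSucc, Fin.snoc_last, Fin.val_castSucc, Fin.val_last, ← hr,
            Function.comp_apply]
          ring

lemma lintegral_pathLaw {E F : Type*} [MeasurableSpace E] [MeasurableSpace F]
    (n : ℕ) (ν : Measure F) (init : Kernel F E) [IsMarkovKernel init]
    (κ : ℕ → Kernel E E) [∀ t, IsMarkovKernel (κ t)]
    (term : Kernel E F) [IsMarkovKernel term]
    {f : F × (Fin (n + 1) → E) × F → ENNReal} (hf : Measurable f) :
    ∫⁻ p, f p ∂(ν.bind (fun x => (init x).bind (fun y =>
        (chainLaw (Measure.dirac y) (fun t z => κ t z) n).bind (fun m =>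
          (term (m (Fin.last n))).map (fun z => (x, m, z))))))
      = ∫⁻ x, ∫⁻ y, ∫⁻ m, ∫⁻ z, f (x, m, z) ∂(term (m (Fin.last n)))
          ∂(chainKernel κ n y) ∂(init x) ∂ν := by
  have h1 : Measurable (fun p : F × (Fin (n + 1) → E) =>
      (term (p.2 (Fin.last n))).map (fun z => (p.1, p.2, z))) :=
    measurable_kernel_map_prodMk
      (term.comap (fun p : F × (Fin (n + 1) → E) => p.2 (Fin.last n)) (by fun_prop))
      (g := fun p z => (p.1, p.2, z)) (by fun_prop)
  have h2 : Measurable (fun p : F × E => (chainKernel κ n p.2).bind (fun m =>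
      (term (m (Fin.last n))).map (fun z => (p.1, m, z)))) :=
    measurable_kernel_bind ((chainKernel κ n).comap (fun p : F × E => p.2) measurable_snd)
      (h := fun p m => (term (m (Fin.last n))).map (fun z => (p.1, m, z)))
      (h1.comp (by fun_prop : Measurable fun q : (F × E) × (Fin (n + 1) → E) => (q.1.1, q.2)))
  have h3 : Measurable (fun x => (init x).bind (fun y => (chainKernel κ n y).bind (fun m =>
      (term (m (Fin.last n))).map (fun z => (x, m, z))))) :=
    measurable_kernel_bind init h2
  refine (Measure.lintegral_bind h3.aemeasurable hf.aemeasurable).trans ?_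
  refine lintegral_congr fun x => ?_
  refine (Measure.lintegral_bind (h2.comp measurable_prodMk_left).aemeasurable
    hf.aemeasurable).trans ?_
  refine lintegral_congr fun y => ?_
  refine (Measure.lintegral_bind (h1.comp measurable_prodMk_left).aemeasurable
    hf.aemeasurable).trans ?_
  exact lintegral_congr fun m => lintegral_map hf (by fun_prop)

/-- Given a time reversal of the first step, the path integral is an integral over the interior
chain with both end points integrated out. -/
lemma lintegral_pathLaw_of_reverse {E F : Type*} [MeasurableSpace E] [MeasurableSpace F]
    (n : ℕ) {ν : Measure F} {ρ : Measure E} {init : Kernel F E} [IsMarkovKernel init]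
    {init' : Kernel E F} [IsMarkovKernel init']
    (κ : ℕ → Kernel E E) [∀ t, IsMarkovKernel (κ t)]
    (term : Kernel E F) [IsMarkovKernel term]
    (h : ν.bind (fun x => (init x).map (fun y => (x, y)))
      = (ρ.bind (fun y => (init' y).map (fun x => (y, x)))).map Prod.swap)
    {f : F × (Fin (n + 1) → E) × F → ENNReal} (hf : Measurable f) :
    ∫⁻ p, f p ∂(ν.bind (fun x => (init x).bind (fun y =>
        (chainLaw (Measure.dirac y) (fun t z => κ t z) n).bind (fun m =>
          (term (m (Fin.last n))).map (fun z => (x, m, z))))))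
      = ∫⁻ m, ∫⁻ x, ∫⁻ z, f (x, m, z) ∂(term (m (Fin.last n))) ∂(init' (m 0))
          ∂(chainLaw ρ (fun t z => κ t z) n) := by
  have h1 : Measurable (fun p : F × (Fin (n + 1) → E) =>
      ∫⁻ z, f (p.1, p.2, z) ∂(term (p.2 (Fin.last n)))) :=
    Measurable.lintegral_kernel_prod_right'
      (κ := term.comap (fun p : F × (Fin (n + 1) → E) => p.2 (Fin.last n)) (by fun_prop))
      (f := fun q : (F × (Fin (n + 1) → E)) × F => f (q.1.1, q.1.2, q.2))
      (hf.comp (by fun_prop))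
  have h2 : Measurable (fun p : F × E => ∫⁻ m, ∫⁻ z, f (p.1, m, z) ∂(term (m (Fin.last n)))
      ∂(chainKernel κ n p.2)) :=
    Measurable.lintegral_kernel_prod_right'
      (κ := (chainKernel κ n).comap (fun p : F × E => p.2) measurable_snd)
      (f := fun q : (F × E) × (Fin (n + 1) → E) =>
        ∫⁻ z, f (q.1.1, q.2, z) ∂(term (q.2 (Fin.last n))))
      (h1.comp (by fun_prop : Measurable fun q : (F × E) × (Fin (n + 1) → E) => (q.1.1, q.2)))
  have h3 : Measurable (fun p : E × (Fin (n + 1) → E) =>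
      ∫⁻ x, ∫⁻ z, f (x, p.2, z) ∂(term (p.2 (Fin.last n))) ∂(init' p.1)) :=
    Measurable.lintegral_kernel_prod_right'
      (κ := init'.comap (fun p : E × (Fin (n + 1) → E) => p.1) measurable_fst)
      (f := fun q : (E × (Fin (n + 1) → E)) × F =>
        ∫⁻ z, f (q.2, q.1.2, z) ∂(term (q.1.2 (Fin.last n))))
      (h1.comp (by fun_prop : Measurable fun q : (E × (Fin (n + 1) → E)) × F => (q.2, q.1.2)))
  rw [lintegral_pathLaw n ν init κ term hf, lintegral_lintegral_of_bind_eq_map_swap h h2]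
  refine Eq.trans ?_ (lintegral_chainLaw κ ρ n
    (h3.comp ((measurable_pi_apply 0).prodMk measurable_id))).symm
  refine lintegral_congr fun y => ?_
  rw [lintegral_lintegral_swap h1.aemeasurable]
  exact (lintegral_chainKernel_apply_zero κ n y
    (f := fun y' m => ∫⁻ x, ∫⁻ z, f (x, m, z) ∂(term (m (Fin.last n))) ∂(init' y')) h3).symm

/-- **Extension of the AIS identity with endpoint spaces (Theorem `thm:extensionAIS` of
Andrieu, Doucet, Yıldırım & Chopin).**

Here `τ = n + 2 ≥ 2`.  Probability measures `μ₀, μ_{τ+1}` live on `F`, `μ 1, …, μ τ` on `E`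
with `μ (t+1) ≪ μ t` for `1 ≤ t ≤ τ - 1`, `κ t` is `μ t`-reversible for `2 ≤ t ≤ τ - 1`,
and the endpoint kernels satisfy
`μ₀(dx₀)→Π₁(x₀,dx₁) = swap_*(μ₁(dx₁)←Π₁(x₁,dx₀))` and
`μ_τ(dx_{τ-1})→Π_τ(x_{τ-1},dx_τ) = swap_*(μ_{τ+1}(dx_τ)←Π_τ(x_τ,dx_{τ-1}))`.
With `Π→ = μ₀ ⊗ →Π₁ ⊗ κ₂ ⊗ ⋯ ⊗ κ_{τ-1} ⊗ →Π_τ`, `Π← = μ_{τ+1} ⊗ ←Π_τ ⊗ κ_{τ-1} ⊗ ⋯ ⊗ κ₂ ⊗ ←Π₁`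
on `F × E^{τ-1} × F` and `R` the order-reversing map,
`R_* Π← = Π→.withDensity (fun x => ∏_{t=1}^{τ-1} (dμ_{t+1}/dμ_t)(x_t))`. -/
theorem ais_extension_path_identity {E F : Type*} [MeasurableSpace E] [MeasurableSpace F]
    (n : ℕ)  -- τ := n + 2
    (μ : ℕ → Measure E) [∀ t, IsProbabilityMeasure (μ t)]
    (μF0 μFlast : Measure F) [IsProbabilityMeasure μF0] [IsProbabilityMeasure μFlast]
    (hac : ∀ t, 1 ≤ t → t ≤ n + 1 → μ (t + 1) ≪ μ t)
    (κ : ℕ → Kernel E E) [∀ t, IsMarkovKernel (κ t)]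
    (hrev : ∀ t, 2 ≤ t → t ≤ n + 1 →
      ((μ t).bind (fun x => ((κ t) x).map (fun y => (x, y)))).map Prod.swap
        = (μ t).bind (fun x => ((κ t) x).map (fun y => (x, y))))
    (fwd1 : Kernel F E) [IsMarkovKernel fwd1]
    (bwd1 : Kernel E F) [IsMarkovKernel bwd1]
    (fwdτ : Kernel E F) [IsMarkovKernel fwdτ]
    (bwdτ : Kernel F E) [IsMarkovKernel bwdτ]
    (hend0 : μF0.bind (fun x0 => (fwd1 x0).map (fun x1 => (x0, x1)))
      = ((μ 1).bind (fun x1 => (bwd1 x1).map (fun x0 => (x1, x0)))).map Prod.swap)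
    (hendτ : (μ (n + 2)).bind (fun xe => (fwdτ xe).map (fun xτ => (xe, xτ)))
      = (μFlast.bind (fun xτ => (bwdτ xτ).map (fun xe => (xτ, xe)))).map Prod.swap) :
    (μFlast.bind (fun xτ => (bwdτ xτ).bind (fun xe =>
        (chainLaw (Measure.dirac xe) (fun t x => (κ (n + 2 - t)) x) n).bind (fun m =>
          (bwd1 (m (Fin.last n))).map (fun x0 => (xτ, m, x0)))))).map
      (fun p : F × (Fin (n + 1) → E) × F =>
        (p.2.2, fun i : Fin (n + 1) => p.2.1 i.rev, p.1))
    = (μF0.bind (fun x0 => (fwd1 x0).bind (fun x1 =>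
        (chainLaw (Measure.dirac x1) (fun t x => (κ (t + 1)) x) n).bind (fun m =>
          (fwdτ (m (Fin.last n))).map (fun xτ => (x0, m, xτ)))))).withDensity
        (fun p => ∏ i : Fin (n + 1),
          (μ ((i : ℕ) + 2)).rnDeriv (μ ((i : ℕ) + 1)) (p.2.1 i)) := by
  have hw : Measurable (fun p : F × (Fin (n + 1) → E) × F => ∏ i : Fin (n + 1),
      (μ ((i : ℕ) + 2)).rnDeriv (μ ((i : ℕ) + 1)) (p.2.1 i)) :=
    Finset.measurable_prod _ fun i _ =>
      (Measure.measurable_rnDeriv _ _).comp (by fun_prop)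
  have hR : Measurable (fun p : F × (Fin (n + 1) → E) × F =>
      (p.2.2, fun i : Fin (n + 1) => p.2.1 i.rev, p.1)) := by
    fun_prop
  have hendτ' := congrArg (Measure.map Prod.swap) hendτ
  rw [Measure.map_map measurable_swap measurable_swap, Prod.swap_swap_eq, Measure.map_id] at hendτ'
  refine Measure.ext_of_lintegral _ fun f hf => ?_
  have hG₀ : Measurable (fun p : (Fin (n + 1) → E) × F =>
      ∫⁻ z, f (p.2, p.1, z) ∂(fwdτ (p.1 (Fin.last n)))) :=
    Measurable.lintegral_kernel_prod_right'
      (κ := fwdτ.comap (fun p : (Fin (n + 1) → E) × F => p.1 (Fin.last n)) (by fun_prop))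
      (f := fun q : ((Fin (n + 1) → E) × F) × F => f (q.1.2, q.1.1, q.2))
      (hf.comp (by fun_prop))
  have hG : Measurable (fun m : Fin (n + 1) → E =>
      ∫⁻ x, ∫⁻ z, f (x, m, z) ∂(fwdτ (m (Fin.last n))) ∂(bwd1 (m 0))) :=
    Measurable.lintegral_kernel_prod_right'
      (κ := bwd1.comap (fun m : Fin (n + 1) → E => m 0) (by fun_prop)) hG₀
  rw [lintegral_map hf hR, lintegral_withDensity_eq_lintegral_mul _ hw hf,
    lintegral_pathLaw_of_reverse n (fun t => κ (t + 1)) fwdτ hend0 (hw.mul hf)]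
  refine (lintegral_pathLaw_of_reverse n (fun t => κ (n + 2 - t)) bwd1 hendτ'.symm
    (hf.comp hR)).trans ?_
  refine Eq.trans ?_ ((lintegral_chainLaw_reverse n μ hac κ hrev hG).trans ?_)
  · refine lintegral_congr fun m => ?_
    simp only [Fin.rev_last, Fin.rev_zero]
    exact lintegral_lintegral_swap (hf.comp (by fun_prop)).aemeasurable
  · refine lintegral_congr fun m => ?_
    refine (lintegral_const_mul _ (hG₀.comp measurable_prodMk_left)).symm.trans ?_
    refine lintegral_congr fun x => ?_
    exact (lintegral_const_mul _
      (hf.comp (f := fun z : F => (x, m, z)) (by fun_prop))).symm
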